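/- arXiv:1609.07211 — 3 statements merged into one kernel-verified Lean document; each statement's English description precedes it below -/
import Mathlib

section
/- For every λ ≥ 0 and every real l > 0 there exists a constant C > 0 (depending only on λ and l) such that for all real k ≥ 1 and all real v, one has ∫_{−∞}^{∞} (k² + t²)^{−(7+λ)/2} · (l² + (v − t)²)^{(3+λ)/2} dt ≤ C · k^{−6−λ} · (v² + k²)^{(3+λ)/2}. -/
open MeasureTheory

/-- The intermediate bound
`∫_ℝ (k² + t²)^{−(7+λ)/2}(l² + (v − t)²)^{(3+λ)/2} dt ≪ k^{−6−λ}(v² + k²)^{(3+λ)/2}`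
from Section 5 of the paper. -/
theorem integral_power_bound (lam l : ℝ) (hlam : 0 ≤ lam) (hl : 0 < l) :
    ∃ C : ℝ, 0 < C ∧ ∀ k : ℝ, 1 ≤ k → ∀ v : ℝ,
      (∫ t : ℝ, (k ^ 2 + t ^ 2) ^ (-(7 + lam) / 2) * (l ^ 2 + (v - t) ^ 2) ^ ((3 + lam) / 2)) ≤
        C * k ^ (-6 - lam) * (v ^ 2 + k ^ 2) ^ ((3 + lam) / 2) := by
  refine ⟨(l ^ 2 + 2) ^ ((3 + lam) / 2) * Real.pi, by positivity, ?_⟩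
  intro k hk v
  have hk0 : 0 < k := by linarith
  have hk2 : 1 ≤ k ^ 2 := by nlinarith
  have key : ∀ t : ℝ,
      (k ^ 2 + t ^ 2) ^ (-(7 + lam) / 2) * (l ^ 2 + (v - t) ^ 2) ^ ((3 + lam) / 2) ≤
      (k ^ (-7 - lam) * (l ^ 2 + 2) ^ ((3 + lam) / 2) * (v ^ 2 + k ^ 2) ^ ((3 + lam) / 2)) *
        (1 + (t / k) ^ 2)⁻¹ := by
    intro t
    obtain ⟨s, rfl⟩ : ∃ s, t = k * s := ⟨t / k, by field_simp⟩
    have e1 : k * s / k = s := by field_simp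
    rw [e1]
    have hs : 0 < 1 + s ^ 2 := by positivity
    have h1 : (k ^ 2 + (k * s) ^ 2) ^ (-(7 + lam) / 2) =
        k ^ (-7 - lam) * (1 + s ^ 2) ^ (-(7 + lam) / 2) := by
      rw [show k ^ 2 + (k * s) ^ 2 = k ^ 2 * (1 + s ^ 2) by ring,
        Real.mul_rpow (by positivity) hs.le, ← Real.rpow_natCast k 2, ← Real.rpow_mul hk0.le]
      congr 2
      push_cast
      ring
    have h2 : (l ^ 2 + (v - k * s) ^ 2) ^ ((3 + lam) / 2) ≤
        (l ^ 2 + 2) ^ ((3 + lam) / 2) * (v ^ 2 + k ^ 2) ^ ((3 + lam) / 2) *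
          (1 + s ^ 2) ^ ((3 + lam) / 2) := by
      rw [← Real.mul_rpow (by positivity) (by positivity),
        ← Real.mul_rpow (by positivity) (by positivity)]
      apply Real.rpow_le_rpow (by positivity) _ (by positivity)
      have a1 : l ^ 2 ≤ l ^ 2 * k ^ 2 := le_mul_of_one_le_right (by positivity) hk2
      have a2 : 0 ≤ l ^ 2 * v ^ 2 + l ^ 2 * v ^ 2 * s ^ 2 + l ^ 2 * k ^ 2 * s ^ 2
        + 2 * v ^ 2 * s ^ 2 + 2 * k ^ 2 := by positivity
      nlinarith [sq_nonneg (v + k * s)]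
    have h3 : (1 + s ^ 2) ^ (-(7 + lam) / 2) * (1 + s ^ 2) ^ ((3 + lam) / 2) ≤
        (1 + s ^ 2)⁻¹ := by
      rw [← Real.rpow_add hs, ← Real.rpow_neg_one]
      apply Real.rpow_le_rpow_of_exponent_le
      · nlinarith [sq_nonneg s]
      · linarith
    rw [h1]
    calc _ ≤ k ^ (-7 - lam) * (1 + s ^ 2) ^ (-(7 + lam) / 2) *
          ((l ^ 2 + 2) ^ ((3 + lam) / 2) * (v ^ 2 + k ^ 2) ^ ((3 + lam) / 2) *
          (1 + s ^ 2) ^ ((3 + lam) / 2)) := by gcongr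
      _ = (k ^ (-7 - lam) * (l ^ 2 + 2) ^ ((3 + lam) / 2) * (v ^ 2 + k ^ 2) ^ ((3 + lam) / 2)) *
          ((1 + s ^ 2) ^ (-(7 + lam) / 2) * (1 + s ^ 2) ^ ((3 + lam) / 2)) := by ring
      _ ≤ _ := by gcongr
  have hint : Integrable (fun t : ℝ => (1 + (t / k) ^ 2)⁻¹) :=
    integrable_inv_one_add_sq.comp_div hk0.ne'
  have hval : ∫ t : ℝ, (1 + (t / k) ^ 2)⁻¹ = k * Real.pi := by
    rw [Measure.integral_comp_div (fun x : ℝ => (1 + x ^ 2)⁻¹) k, integral_univ_inv_one_add_sq,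
      abs_of_pos hk0, smul_eq_mul]
  refine (integral_mono_of_nonneg (Filter.Eventually.of_forall fun t => ?_)
    (hint.const_mul _) (Filter.Eventually.of_forall key)).trans ?_
  · simp only [Pi.zero_apply]
    positivity
  · rw [integral_const_mul, hval]
    have : k ^ (-6 - lam) = k ^ (-7 - lam) * k := by
      rw [← Real.rpow_add_one hk0.ne']
      congr 1
      ring
    rw [this]
    apply le_of_eq
    ring
end

section
/- For every λ ≥ 0 there exists a constant C > 0 (depending only on λ) such that for all real k > 0 and all real v, one has ∫_{−π/2}^{π/2} cos(θ)^{5+λ} · (v² + k² · tan(θ)²)^{(3+λ)/2} dθ ≤ C · (v² + k²)^{(3+λ)/2}. -/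
open MeasureTheory Real

/-- The final step in the estimation of the integral `I_j(v)` in Section 5,
after the change of variable `t = k·tan(θ)`:
`∫_{−π/2}^{π/2} cos(θ)^{5+λ}(v² + k²tan²(θ))^{(3+λ)/2} dθ ≪ (v² + k²)^{(3+λ)/2}`. -/
theorem cosine_tangent_integral_bound (lam : ℝ) (hlam : 0 ≤ lam) :
    ∃ C : ℝ, 0 < C ∧ ∀ k : ℝ, 0 < k → ∀ v : ℝ,
      (∫ θ in Set.Ioo (-(π / 2)) (π / 2),
          Real.cos θ ^ (5 + lam) * (v ^ 2 + k ^ 2 * Real.tan θ ^ 2) ^ ((3 + lam) / 2)) ≤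
        C * (v ^ 2 + k ^ 2) ^ ((3 + lam) / 2) := by
  refine ⟨π, Real.pi_pos, fun k hk v => ?_⟩
  have hb : ∀ θ ∈ Set.Ioo (-(π / 2)) (π / 2),
      ‖Real.cos θ ^ (5 + lam) * (v ^ 2 + k ^ 2 * Real.tan θ ^ 2) ^ ((3 + lam) / 2)‖ ≤
        (v ^ 2 + k ^ 2) ^ ((3 + lam) / 2) := by
    intro θ hθ
    have hc : 0 < Real.cos θ := Real.cos_pos_of_mem_Ioo hθ
    have h1 : Real.cos θ ^ (5 + lam) =
        Real.cos θ ^ 2 * (Real.cos θ ^ 2) ^ ((3 + lam) / 2) := by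
      rw [← Real.rpow_natCast, ← Real.rpow_mul hc.le, ← Real.rpow_add hc]
      congr 1
      push_cast
      ring
    have hsc := Real.sin_sq_add_cos_sq θ
    have h2 : Real.cos θ ^ 2 * (v ^ 2 + k ^ 2 * Real.tan θ ^ 2) =
        Real.cos θ ^ 2 * v ^ 2 + k ^ 2 * Real.sin θ ^ 2 := by
      rw [Real.tan_eq_sin_div_cos]
      field_simp
    rw [Real.norm_of_nonneg (by positivity), h1, mul_assoc,
      ← Real.mul_rpow (by positivity) (by positivity), h2]
    have hc1 : Real.cos θ ^ 2 ≤ 1 := Real.cos_sq_le_one θ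
    have hs1 : Real.sin θ ^ 2 ≤ 1 := Real.sin_sq_le_one θ
    have h3 : Real.cos θ ^ 2 * v ^ 2 + k ^ 2 * Real.sin θ ^ 2 ≤ v ^ 2 + k ^ 2 := by
      nlinarith [sq_nonneg v, sq_nonneg k]
    have h4 := Real.rpow_le_rpow (by positivity) h3 (show 0 ≤ (3 + lam) / 2 by positivity)
    refine le_trans (mul_le_of_le_one_left (by positivity) hc1) h4
  have h := norm_setIntegral_le_of_norm_le_const (μ := volume) (by simp) hb
  refine (le_trans (Real.le_norm_self _) h).trans_eq ?_
  rw [Real.volume_real_Ioo_of_le (by linarith [Real.pi_pos])]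
  ring
end

section
/- Let F be a totally real number field and let λ₀ > 0 be a real number. Then the family, indexed by the totally positive units η of the ring of integers of F (i.e., units η with σ(η) > 0 for every real embedding σ : F →+* ℝ), of the products ∏_{w} max(1, w(η))^{−λ₀}, where w runs over the infinite places of F, is summable. -/
open NumberField

open scoped Classical in
open NumberField.Units NumberField.Units.dirichletUnitTheorem in
theorem aux_summable_exp (F : Type*) [Field F] [NumberField F] (c : ℝ) (hc : 0 < c) :
    Summable (fun z : unitLattice F => Real.exp (-c * ‖z‖)) := by
  set n := Module.finrank ℤ (unitLattice F) + 1 with hn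
  have h := (ZLattice.summable_norm_pow_inv (unitLattice F) n (by omega)).mul_left
    ((n.factorial : ℝ) * c⁻¹ ^ n)
  refine Summable.of_norm_bounded_eventually h ?_
  refine (Set.finite_singleton (0 : unitLattice F)).subset ?_
  intro z hz
  by_contra h0
  apply hz
  have hz0 : 0 < ‖z‖ := norm_pos_iff.mpr h0
  have h1 := Real.pow_div_factorial_le_exp _ (mul_pos hc hz0).le n
  rw [Set.mem_setOf_eq, Real.norm_eq_abs, Real.abs_exp, neg_mul, Real.exp_neg]
  have hp : 0 < (c * ‖z‖) ^ n / (n.factorial : ℝ) := by positivity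
  refine (inv_anti₀ hp h1).trans (le_of_eq ?_)
  rw [inv_div, mul_pow, inv_pow, inv_pow]
  field_simp

open scoped Classical in
open NumberField.Units NumberField.Units.dirichletUnitTheorem in
theorem aux_bound (F : Type*) [Field F] [NumberField F]
    (hF : ∀ w : NumberField.InfinitePlace F, w.IsReal) (c : ℝ) (hc : 0 < c) (u : (𝓞 F)ˣ) :
    ∏ w : NumberField.InfinitePlace F, (max 1 (w ((u : 𝓞 F) : F))) ^ (-c) ≤
      Real.exp (-c * ‖logEmbedding F (Additive.ofMul u)‖) := by
  have hm : ∀ w : InfinitePlace F, w.mult = 1 := fun w => by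
    simp [InfinitePlace.mult, hF w]
  have hs := sum_mult_mul_log u
  simp only [hm, Nat.cast_one, one_mul] at hs
  have hlog : ∀ w : InfinitePlace F, (max 1 (w ((u : 𝓞 F) : F))) ^ (-c) =
      Real.exp (-c * max 0 (Real.log (w ((u : 𝓞 F) : F)))) := fun w => by
    have hw : 0 < w ((u : 𝓞 F) : F) := pos_at_place u w
    rw [Real.rpow_def_of_pos (by positivity), mul_comm]
    congr 2
    rcases le_total 1 (w ((u : 𝓞 F) : F)) with h | h
    · rw [max_eq_right h, max_eq_right (Real.log_nonneg h)]
    · rw [max_eq_left h, max_eq_left (Real.log_nonpos hw.le h), Real.log_one]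
  rw [Finset.prod_congr rfl (fun w _ => hlog w), ← Real.exp_sum, ← Finset.mul_sum]
  apply Real.exp_le_exp.mpr
  apply mul_le_mul_of_nonpos_left _ (by linarith)
  set S := ∑ w : InfinitePlace F, max 0 (Real.log (w ((u : 𝓞 F) : F)))
  have hS : 0 ≤ S := Finset.sum_nonneg fun w _ => le_max_left _ _
  refine (pi_norm_le_iff_of_nonneg hS).mpr fun w => ?_
  rw [logEmbedding_component, hm, Nat.cast_one, one_mul, Real.norm_eq_abs, abs_le]
  constructor
  · have h1 := Finset.single_le_sum
      (f := fun w : InfinitePlace F => max 0 (Real.log (w ((u : 𝓞 F) : F))) -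
        Real.log (w ((u : 𝓞 F) : F)))
      (fun i _ => sub_nonneg.mpr (le_max_right _ _)) (Finset.mem_univ w.1)
    rw [Finset.sum_sub_distrib, hs] at h1
    have h2 := le_max_left 0 (Real.log (w.1 ((u : 𝓞 F) : F)))
    linarith
  · exact (le_max_right 0 _).trans (Finset.single_le_sum
      (f := fun w : InfinitePlace F => max 0 (Real.log (w ((u : 𝓞 F) : F))))
      (fun i _ => le_max_left _ _) (Finset.mem_univ w.1))

/-- Luo's convergence fact (equation (5.2) in the paper): for a totally real
number field `F` and `λ₀ > 0`, the sum over totally positive units `η` of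
`∏_{w ∣ ∞} max(1, |η|_w)^{−λ₀}` converges. -/
theorem summable_totally_positive_units (F : Type*) [Field F] [NumberField F]
    (hF : ∀ w : NumberField.InfinitePlace F, w.IsReal) (lam₀ : ℝ) (hlam₀ : 0 < lam₀) :
    Summable (fun η : {u : (𝓞 F)ˣ // ∀ σ : F →+* ℝ, 0 < σ ((u : 𝓞 F) : F)} =>
      ∏ w : NumberField.InfinitePlace F, (max 1 (w (((η : (𝓞 F)ˣ) : 𝓞 F) : F))) ^ (-lam₀)) := by
  let φ : {u : (𝓞 F)ˣ // ∀ σ : F →+* ℝ, 0 < σ ((u : 𝓞 F) : F)} → Units.unitLattice F :=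
    fun η => ⟨Units.logEmbedding F (Additive.ofMul η.1), ⟨Additive.ofMul η.1, trivial, rfl⟩⟩
  have hφ : Function.Injective φ := by
    intro a b hab
    have h1 : Units.logEmbedding F (Additive.ofMul a.1) =
      Units.logEmbedding F (Additive.ofMul b.1) := congrArg Subtype.val hab
    have h2 : Units.logEmbedding F (Additive.ofMul (a.1 / b.1)) = 0 := by
      rw [ofMul_div, map_sub, h1, sub_self]
    rw [Units.dirichletUnitTheorem.logEmbedding_eq_zero_iff, Units.mem_torsion] at h2
    obtain ⟨w⟩ : Nonempty (InfinitePlace F) := inferInstance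
    have h3 : w ((a.1 : 𝓞 F) : F) = w ((b.1 : 𝓞 F) : F) := by
      have h4 : (a.1 : F) = ((a.1 / b.1 : (𝓞 F)ˣ) : F) * (b.1 : F) := by
        rw [← Units.coe_mul, div_mul_cancel]
      rw [Units.coe_coe, Units.coe_coe, h4, map_mul, h2 w, one_mul]
    rw [← InfinitePlace.norm_embedding_of_isReal (hF w),
      ← InfinitePlace.norm_embedding_of_isReal (hF w), Real.norm_of_nonneg (a.2 _).le,
      Real.norm_of_nonneg (b.2 _).le] at h3
    exact Subtype.ext (Units.coe_injective F (RingHom.injective _ h3))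
  have h1 := (aux_summable_exp F lam₀ hlam₀).comp_injective hφ
  refine Summable.of_nonneg_of_le (fun η => ?_) (fun η => ?_) h1
  · exact Finset.prod_nonneg fun w _ => Real.rpow_nonneg (zero_le_one.trans (le_max_left _ _)) _
  · exact aux_bound F hF lam₀ hlam₀ η.1
end
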